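/- The three half-bone relations hold: Z·x·x·Y = −I, Y·z·z·X = −I, and Z·X·y·y = −I; i.e., each 'half' of a bone boundary word evaluates to minus the identity. -/

import Mathlib

open Matrix

/-- `ω = exp(2πi/12)`, a primitive 12th root of unity. -/
noncomputable def ω : ℂ := Complex.exp (2 * Real.pi * Complex.I / 12)

/-- The SL₂(ℂ) connection matrix on northeast edges. -/
noncomputable def α : Matrix (Fin 2) (Fin 2) ℂ := !![ω^7, 0; 0, ω^5]

/-- The SL₂(ℂ) connection matrix on northwest edges. -/
noncomputable def β : Matrix (Fin 2) (Fin 2) ℂ := !![ω^7, ω^3; 0, ω^5]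

/-- The SL₂(ℂ) connection matrix on horizontal edges. -/
noncomputable def γ : Matrix (Fin 2) (Fin 2) ℂ := !![ω^5, 0; ω^3, ω^7]

/-- The length-two move `X = β·α`. -/
noncomputable def X : Matrix (Fin 2) (Fin 2) ℂ := β * α

/-- The length-two move `Y = α⁻¹·γ`. -/
noncomputable def Y : Matrix (Fin 2) (Fin 2) ℂ := α⁻¹ * γ

/-- The length-two move `Z = γ⁻¹·β⁻¹`. -/
noncomputable def Z : Matrix (Fin 2) (Fin 2) ℂ := γ⁻¹ * β⁻¹

/-- `x = X⁻¹`. -/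
noncomputable def x : Matrix (Fin 2) (Fin 2) ℂ := X⁻¹

/-- `y = Y⁻¹`. -/
noncomputable def y : Matrix (Fin 2) (Fin 2) ℂ := Y⁻¹

/-- `z = Z⁻¹`. -/
noncomputable def z : Matrix (Fin 2) (Fin 2) ℂ := Z⁻¹

theorem ω_pow_four : ω ^ 4 = ω ^ 2 - 1 := by
  have hω : IsPrimitiveRoot ω 12 := by
    simpa [ω] using Complex.isPrimitiveRoot_exp 12 (by norm_num)
  have h6 : ω ^ 6 = -1 :=
    (hω.pow (by norm_num) (by norm_num : 12 = 6 * 2)).eq_neg_one_of_two_right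
  have hne : ω ^ 2 + 1 ≠ 0 := fun h =>
    hω.pow_ne_one_of_pos_of_lt (l := 4) (by norm_num) (by norm_num)
      (by linear_combination (ω ^ 2 - 1) * h)
  apply mul_left_cancel₀ hne
  linear_combination h6

theorem inv_fin_two_of_det_eq_one {R : Type*} [CommRing R] {a b c d : R}
    (h : a * d - b * c = 1) : (!![a, b; c, d])⁻¹ = !![d, -b; -c, a] := by
  rw [Matrix.inv_def, Matrix.det_fin_two_of, h, Ring.inverse_one, one_smul,
    Matrix.adjugate_fin_two_of]

theorem X_eq : X = !![ω ^ 2, -ω ^ 2; 0, 1 - ω ^ 2] := by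
  have h := ω_pow_four
  rw [X, β, α, Matrix.mul_fin_two]
  simp only [EmbeddingLike.apply_eq_iff_eq, Matrix.vecCons_inj, and_true]
  grind

theorem Y_eq : Y = !![1 - ω ^ 2, 0; 1 - ω ^ 2, ω ^ 2] := by
  have h := ω_pow_four
  rw [Y, α, γ, inv_fin_two_of_det_eq_one (by grind), Matrix.mul_fin_two]
  simp only [EmbeddingLike.apply_eq_iff_eq, Matrix.vecCons_inj, and_true]
  grind

theorem Z_eq : Z = !![1, ω ^ 2 - 1; ω ^ 2, 0] := by
  have h := ω_pow_four
  rw [Z, β, γ, inv_fin_two_of_det_eq_one (by grind), inv_fin_two_of_det_eq_one (by grind),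
    Matrix.mul_fin_two]
  simp only [EmbeddingLike.apply_eq_iff_eq, Matrix.vecCons_inj, and_true]
  grind

/-- The three half-bone relations: each half of a bone boundary word is `-I`. -/
theorem half_bone_relations :
    Z * x * x * Y = -(1 : Matrix (Fin 2) (Fin 2) ℂ) ∧
    Y * z * z * X = -(1 : Matrix (Fin 2) (Fin 2) ℂ) ∧
    Z * X * y * y = -(1 : Matrix (Fin 2) (Fin 2) ℂ) := by
  have h := ω_pow_four
  rw [x, y, z, X_eq, Y_eq, Z_eq, inv_fin_two_of_det_eq_one (by grind),
    inv_fin_two_of_det_eq_one (by grind), inv_fin_two_of_det_eq_one (by grind),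
    Matrix.one_fin_two]
  simp only [Matrix.mul_fin_two, Matrix.neg_of, Matrix.neg_cons, Matrix.neg_empty,
    EmbeddingLike.apply_eq_iff_eq, Matrix.vecCons_inj, and_true]
  grind
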